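/- Let H ≥ 1 be an integer, V ∈ ℝ^S, and let (μ,ν) be an H-step lookahead policy for V. Then ‖J^{μ,ν} − T^{H−1}V‖_∞ ≤ (α^{H−1}(1+α)/(1−α))·‖V − J*‖_∞. -/

import Mathlib

open Finset Filter Topology Matrix

noncomputable section

/-- The probability simplex over a finite subset `D` of actions: nonnegative
weights summing to one over `D` and vanishing outside `D`. -/
def simplex {A : Type*} [Fintype A] (D : Finset A) : Set (A → ℝ) :=
  {p | (∀ a, 0 ≤ p a) ∧ (∑ a ∈ D, p a = 1) ∧ ∀ a ∉ D, p a = 0}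

/-- A finite two-player zero-sum discounted Markov game. `S` is the state space,
`A` the maximizer's global action type, `B` the minimizer's global action type. -/
structure MarkovGame (S A B : Type*) [Fintype S] [Fintype A] [Fintype B] where
  U : S → Finset A
  W : S → Finset B
  U_nonempty : ∀ s, (U s).Nonempty
  W_nonempty : ∀ s, (W s).Nonempty
  P : S → A → B → S → ℝ
  P_nonneg : ∀ s u v s', 0 ≤ P s u v s'
  P_sum : ∀ s, ∀ u ∈ U s, ∀ v ∈ W s, ∑ s', P s u v s' = 1
  g : S → A → B → ℝ
  g_nonneg : ∀ s u v, 0 ≤ g s u v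
  g_le_one : ∀ s u v, g s u v ≤ 1
  α : ℝ
  α_pos : 0 < α
  α_lt_one : α < 1

namespace MarkovGame

variable {S A B : Type*} [Fintype S] [Fintype A] [Fintype B]

/-- The state-action value matrix `A_{V,s}(u,v) = g(s,u,v) + α Σ_{s'} P(s'|s,u,v) V(s')`. -/
def Aval (G : MarkovGame S A B) (V : S → ℝ) (s : S) (u : A) (v : B) : ℝ :=
  G.g s u v + G.α * ∑ s', G.P s u v s' * V s'

/-- A policy pair assigns to each state probability vectors over the available actions. -/
def IsPolicy (G : MarkovGame S A B) (μ : S → A → ℝ) (ν : S → B → ℝ) : Prop :=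
  ∀ s, μ s ∈ simplex (G.U s) ∧ ν s ∈ simplex (G.W s)

/-- The Bellman operator of a policy pair: `(T_{μ,ν}V)(s) = μ(s)ᵀ A_{V,s} ν(s)`. -/
def Tpol (G : MarkovGame S A B) (μ : S → A → ℝ) (ν : S → B → ℝ) (V : S → ℝ) : S → ℝ :=
  fun s => ∑ u ∈ G.U s, ∑ v ∈ G.W s, μ s u * ν s v * G.Aval V s u v

/-- The Bellman optimality operator:
`(TV)(s) = max_{p ∈ Δ(U(s))} min_{q ∈ Δ(V(s))} pᵀ A_{V,s} q`. -/
def T (G : MarkovGame S A B) (V : S → ℝ) : S → ℝ :=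
  fun s => sSup {x | ∃ p ∈ simplex (G.U s),
    x = sInf {y | ∃ q ∈ simplex (G.W s),
      y = ∑ u ∈ G.U s, ∑ v ∈ G.W s, p u * q v * G.Aval V s u v}}

/-- The transition matrix `P_{μ,ν}` of a policy pair. -/
def Ppol (G : MarkovGame S A B) (μ : S → A → ℝ) (ν : S → B → ℝ) : Matrix S S ℝ :=
  Matrix.of fun s s' => ∑ u ∈ G.U s, ∑ v ∈ G.W s, μ s u * ν s v * G.P s u v s'

/-- The expected one-step reward `g_{μ,ν}` of a policy pair. -/
def gpol (G : MarkovGame S A B) (μ : S → A → ℝ) (ν : S → B → ℝ) : S → ℝ :=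
  fun s => ∑ u ∈ G.U s, ∑ v ∈ G.W s, μ s u * ν s v * G.g s u v

/-- `(μ,ν)` is an `H`-step lookahead policy for `V` if it is a policy pair and
`T_{μ,ν}(T^{H-1}V) = T^H V`. -/
def IsLookahead (G : MarkovGame S A B) (H : ℕ) (μ : S → A → ℝ) (ν : S → B → ℝ)
    (V : S → ℝ) : Prop :=
  G.IsPolicy μ ν ∧ G.Tpol μ ν (G.T^[H - 1] V) = G.T^[H] V

end MarkovGame
namespace MarkovGame

variable {S A B : Type*} [Fintype S] [Fintype A] [Fintype B]

/-- The expected one-step value of mixed actions `p`, `q` at state `s` with continuation `V`. -/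
def mixedVal (G : MarkovGame S A B) (V : S → ℝ) (s : S) (p : A → ℝ) (q : B → ℝ) : ℝ :=
  ∑ u ∈ G.U s, ∑ v ∈ G.W s, p u * q v * G.Aval V s u v

lemma sum_mul_simplex_eq {D : Finset A} {E : Finset B} {p : A → ℝ} {q : B → ℝ}
    (hp : p ∈ simplex D) (hq : q ∈ simplex E) (c : ℝ) :
    ∑ u ∈ D, ∑ v ∈ E, p u * q v * c = c := by
  simp_rw [← Finset.sum_mul, ← Finset.mul_sum, hq.2.1, mul_one]
  rw [hp.2.1, one_mul]

lemma simplex_nonempty {D : Finset A} (hD : D.Nonempty) : (simplex D).Nonempty := by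
  classical
  obtain ⟨a, ha⟩ := hD
  refine ⟨Pi.single a 1, fun b => ?_, ?_, fun b hb => ?_⟩
  · by_cases h : b = a
    · subst h; simp
    · simp [h]
  · simp [Pi.single_apply, ha]
  · have : b ≠ a := fun h => hb (h ▸ ha)
    simp [this]

lemma Aval_le_add (G : MarkovGame S A B) (V W : S → ℝ) (s : S) {u : A} (hu : u ∈ G.U s)
    {v : B} (hv : v ∈ G.W s) : G.Aval V s u v ≤ G.Aval W s u v + G.α * ‖V - W‖ := by
  have h : ∑ s', G.P s u v s' * V s' ≤ ∑ s', G.P s u v s' * W s' + ‖V - W‖ := by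
    calc ∑ s', G.P s u v s' * V s'
        ≤ ∑ s', (G.P s u v s' * W s' + G.P s u v s' * ‖V - W‖) := by
          refine Finset.sum_le_sum fun s' _ => ?_
          rw [← mul_add]
          refine mul_le_mul_of_nonneg_left ?_ (G.P_nonneg s u v s')
          have h₁ := (le_abs_self _).trans (norm_le_pi_norm (V - W) s')
          rw [Pi.sub_apply] at h₁
          linarith
      _ = _ := by rw [Finset.sum_add_distrib, ← Finset.sum_mul, G.P_sum s u hu v hv, one_mul]
  have := mul_le_mul_of_nonneg_left h G.α_pos.le
  unfold Aval
  linarith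

lemma mixedVal_le_add (G : MarkovGame S A B) (V W : S → ℝ) (s : S) {p : A → ℝ} {q : B → ℝ}
    (hp : p ∈ simplex (G.U s)) (hq : q ∈ simplex (G.W s)) :
    G.mixedVal V s p q ≤ G.mixedVal W s p q + G.α * ‖V - W‖ := by
  conv_rhs => rw [← sum_mul_simplex_eq hp hq (G.α * ‖V - W‖)]
  simp_rw [mixedVal, ← Finset.sum_add_distrib, ← mul_add]
  exact Finset.sum_le_sum fun u hu => Finset.sum_le_sum fun v hv =>
    mul_le_mul_of_nonneg_left (G.Aval_le_add V W s hu hv) (mul_nonneg (hp.1 u) (hq.1 v))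

lemma mixedVal_zero_mem_Icc (G : MarkovGame S A B) (s : S) {p : A → ℝ} {q : B → ℝ}
    (hp : p ∈ simplex (G.U s)) (hq : q ∈ simplex (G.W s)) :
    G.mixedVal 0 s p q ∈ Set.Icc (0 : ℝ) 1 := by
  constructor
  · refine Finset.sum_nonneg fun u _ => Finset.sum_nonneg fun v _ =>
      mul_nonneg (mul_nonneg (hp.1 u) (hq.1 v)) ?_
    simpa [Aval] using G.g_nonneg s u v
  · rw [← sum_mul_simplex_eq hp hq 1]
    refine Finset.sum_le_sum fun u _ => Finset.sum_le_sum fun v _ =>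
      mul_le_mul_of_nonneg_left ?_ (mul_nonneg (hp.1 u) (hq.1 v))
    simpa [Aval] using G.g_le_one s u v

lemma mixedVal_le (G : MarkovGame S A B) (V : S → ℝ) (s : S) {p : A → ℝ} {q : B → ℝ}
    (hp : p ∈ simplex (G.U s)) (hq : q ∈ simplex (G.W s)) :
    G.mixedVal V s p q ≤ 1 + G.α * ‖V‖ := by
  have h := G.mixedVal_le_add V 0 s hp hq
  rw [sub_zero] at h
  linarith [(G.mixedVal_zero_mem_Icc s hp hq).2]

lemma neg_le_mixedVal (G : MarkovGame S A B) (V : S → ℝ) (s : S) {p : A → ℝ} {q : B → ℝ}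
    (hp : p ∈ simplex (G.U s)) (hq : q ∈ simplex (G.W s)) :
    -(G.α * ‖V‖) ≤ G.mixedVal V s p q := by
  have h := G.mixedVal_le_add 0 V s hp hq
  rw [zero_sub, norm_neg] at h
  linarith [(G.mixedVal_zero_mem_Icc s hp hq).1]

lemma T_le_add (G : MarkovGame S A B) (V W : S → ℝ) (s : S) :
    G.T V s ≤ G.T W s + G.α * ‖V - W‖ := by
  obtain ⟨p₀, hp₀⟩ := simplex_nonempty (G.U_nonempty s)
  obtain ⟨q₀, hq₀⟩ := simplex_nonempty (G.W_nonempty s)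
  have bdd (X : S → ℝ) {p : A → ℝ} (hp : p ∈ simplex (G.U s)) :
      BddBelow {y | ∃ q ∈ simplex (G.W s), y = G.mixedVal X s p q} :=
    ⟨-(G.α * ‖X‖), by rintro _ ⟨q, hq, rfl⟩; exact G.neg_le_mixedVal X s hp hq⟩
  refine csSup_le ⟨_, p₀, hp₀, rfl⟩ ?_
  rintro _ ⟨p, hp, rfl⟩
  have hinf : sInf {y | ∃ q ∈ simplex (G.W s), y = G.mixedVal V s p q} - G.α * ‖V - W‖ ≤
      sInf {y | ∃ q ∈ simplex (G.W s), y = G.mixedVal W s p q} := by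
    refine le_csInf ⟨_, q₀, hq₀, rfl⟩ ?_
    rintro _ ⟨q, hq, rfl⟩
    have h₁ := csInf_le (bdd V hp) ⟨q, hq, rfl⟩
    have h₂ := G.mixedVal_le_add V W s hp hq
    linarith
  have hsup : sInf {y | ∃ q ∈ simplex (G.W s), y = G.mixedVal W s p q} ≤ G.T W s := by
    refine le_csSup ⟨1 + G.α * ‖W‖, ?_⟩ ⟨p, hp, rfl⟩
    rintro _ ⟨p', hp', rfl⟩
    exact (csInf_le (bdd W hp') ⟨q₀, hq₀, rfl⟩).trans (G.mixedVal_le W s hp' hq₀)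
  exact sub_le_iff_le_add.mp (hinf.trans hsup)

lemma norm_sub_le_of_forall_le_add (G : MarkovGame S A B) {F : (S → ℝ) → S → ℝ}
    (hF : ∀ V W s, F V s ≤ F W s + G.α * ‖V - W‖) (V W : S → ℝ) :
    ‖F V - F W‖ ≤ G.α * ‖V - W‖ := by
  refine (pi_norm_le_iff_of_nonneg (mul_nonneg G.α_pos.le (norm_nonneg _))).2 fun s => ?_
  have h₁ := hF V W s
  have h₂ := hF W V s
  rw [norm_sub_rev W V] at h₂
  rw [Pi.sub_apply, Real.norm_eq_abs, abs_le]
  constructor <;> linarith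

lemma norm_T_sub_le (G : MarkovGame S A B) (V W : S → ℝ) :
    ‖G.T V - G.T W‖ ≤ G.α * ‖V - W‖ :=
  G.norm_sub_le_of_forall_le_add G.T_le_add V W

lemma norm_Tpol_sub_le (G : MarkovGame S A B) {μ : S → A → ℝ} {ν : S → B → ℝ}
    (h : G.IsPolicy μ ν) (V W : S → ℝ) :
    ‖G.Tpol μ ν V - G.Tpol μ ν W‖ ≤ G.α * ‖V - W‖ :=
  G.norm_sub_le_of_forall_le_add (F := G.Tpol μ ν)
    (fun V W s => G.mixedVal_le_add V W s (h s).1 (h s).2) V W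

lemma norm_iterate_T_sub_le (G : MarkovGame S A B) {J : S → ℝ} (hJ : G.T J = J) (V : S → ℝ)
    (n : ℕ) : ‖G.T^[n] V - J‖ ≤ G.α ^ n * ‖V - J‖ := by
  induction n with
  | zero => simp
  | succ n ih =>
    rw [Function.iterate_succ_apply']
    calc ‖G.T (G.T^[n] V) - J‖ = ‖G.T (G.T^[n] V) - G.T J‖ := by rw [hJ]
      _ ≤ G.α * ‖G.T^[n] V - J‖ := G.norm_T_sub_le _ _
      _ ≤ G.α * (G.α ^ n * ‖V - J‖) := mul_le_mul_of_nonneg_left ih G.α_pos.le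
      _ = G.α ^ (n + 1) * ‖V - J‖ := by ring

end MarkovGame

/-- If `(μ,ν)` is an `H`-step lookahead policy for `V`, then
`‖J^{μ,ν} − T^{H−1}V‖_∞ ≤ (α^{H−1}(1+α)/(1−α))‖V − J*‖_∞`. -/
theorem stmt_8 {S A B : Type*} [Fintype S] [Fintype A] [Fintype B]
    (G : MarkovGame S A B) (H : ℕ) (hH : 1 ≤ H) (V : S → ℝ)
    (μ : S → A → ℝ) (ν : S → B → ℝ) (hLA : G.IsLookahead H μ ν V)
    (Jmn : S → ℝ) (hfix : G.Tpol μ ν Jmn = Jmn)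
    (Jstar : S → ℝ) (hJ : G.T Jstar = Jstar) :
    ‖Jmn - G.T^[H - 1] V‖ ≤
      (G.α ^ (H - 1) * (1 + G.α) / (1 - G.α)) * ‖V - Jstar‖ := by
  obtain ⟨n, rfl⟩ : ∃ n, H = n + 1 := ⟨H - 1, by omega⟩
  obtain ⟨hpol, hT⟩ := hLA
  rw [Function.iterate_succ_apply'] at hT
  rw [Nat.add_sub_cancel] at *
  have hX := G.norm_iterate_T_sub_le hJ V n
  set X := G.T^[n] V
  have h₁ : ‖Jmn - G.T X‖ ≤ G.α * ‖Jmn - X‖ := by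
    simpa only [hfix, hT] using G.norm_Tpol_sub_le hpol Jmn X
  have h₂ : ‖G.T X - Jstar‖ ≤ G.α * ‖X - Jstar‖ := by
    simpa only [hJ] using G.norm_T_sub_le X Jstar
  have h₃ := norm_sub_le_norm_sub_add_norm_sub Jmn (G.T X) X
  have h₄ := norm_sub_le_norm_sub_add_norm_sub (G.T X) Jstar X
  rw [norm_sub_rev Jstar X] at h₄
  have h₅ := mul_le_mul_of_nonneg_left hX (by linarith [G.α_pos] : 0 ≤ 1 + G.α)
  rw [div_mul_eq_mul_div, le_div_iff₀ (by linarith [G.α_lt_one])]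
  linarith
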